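/- Let ν ≥ 2, γ = (ν−2)/√(ν−1), ε > 0, and let p, h : (−1,1) → ℝ satisfy: (a) for all x ∈ (−1,1), √(h(x) − p(x)²)/√(ν−1) ≤ p(x) + 1/(1+x) ≤ √(ν−1)·√(h(x) − p(x)²) and √(h(x) − p(x)²)/√(ν−1) ≤ −p(x) + 1/(1−x) ≤ √(ν−1)·√(h(x) − p(x)²); and (b) for every x₀ ∈ (−1,1) and every x with Hilbert distance d(x₀,x) < ε, p₋(x) ≤ p(x) ≤ p₊(x), where p₋, p₊ are the extremal solutions of p'' = 6p'p − 4p³ ∓/± 2γ(p' − p²)^{3/2} with initial conditions p±(x₀) = p(x₀), p±'(x₀) = h(x₀). Then the function f(x) = ∫₀ˣ p(s) ds is ν-admissible on C = [−1,1], and it satisfies −((ν−1)/ν)·log(1+|x|) − (1/ν)·log(1−|x|) ≤ f(x) ≤ −((ν−1)/ν)·log(1−|x|) − (1/ν)·log(1+|x|) for all x ∈ (−1,1); in particular f(x) grows asymptotically proportionally to −log(1−|x|) as x → ±1. -/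

import Mathlib

/-- ζ₊(x,u) for a 1-dimensional function: 6h p − 4p³ + 2γ(h − p²)^{3/2}. -/
noncomputable def zetaPlus (γ p h : ℝ) : ℝ :=
  6 * h * p - 4 * p ^ 3 + 2 * γ * (h - p ^ 2) ^ ((3 : ℝ) / 2)

/-- ζ₋(x,u) for a 1-dimensional function: 6h p − 4p³ − 2γ(h − p²)^{3/2}. -/
noncomputable def zetaMinus (γ p h : ℝ) : ℝ :=
  6 * h * p - 4 * p ^ 3 - 2 * γ * (h - p ^ 2) ^ ((3 : ℝ) / 2)

/-- A C² function f on (−1,1) is ν-admissible on C = [−1,1]: f'' − f'² > 0, f blows up at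
both endpoints, and the second derivative satisfies the one-sided Lipschitz-type bounds
ζ₋ ≤ liminf/limsup of its difference quotients ≤ ζ₊, where γ = (ν−2)/√(ν−1). -/
noncomputable def Admissible1D (ν : ℝ) (f : ℝ → ℝ) : Prop :=
  ContDiffOn ℝ 2 f (Set.Ioo (-1 : ℝ) 1) ∧
  (∀ x ∈ Set.Ioo (-1 : ℝ) 1, 0 < deriv (deriv f) x - (deriv f x) ^ 2) ∧
  Filter.Tendsto f (nhdsWithin 1 (Set.Ioo (-1 : ℝ) 1)) Filter.atTop ∧
  Filter.Tendsto f (nhdsWithin (-1) (Set.Ioo (-1 : ℝ) 1)) Filter.atTop ∧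
  (∀ x ∈ Set.Ioo (-1 : ℝ) 1,
    Filter.limsup (fun ε => (deriv (deriv f) (x + ε) - deriv (deriv f) x) / ε)
        (nhdsWithin (0 : ℝ) {(0 : ℝ)}ᶜ)
      ≤ zetaPlus ((ν - 2) / Real.sqrt (ν - 1)) (deriv f x) (deriv (deriv f) x) ∧
    zetaMinus ((ν - 2) / Real.sqrt (ν - 1)) (deriv f x) (deriv (deriv f) x)
      ≤ Filter.liminf (fun ε => (deriv (deriv f) (x + ε) - deriv (deriv f) x) / ε)
        (nhdsWithin (0 : ℝ) {(0 : ℝ)}ᶜ))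
/-- Denominator of the extremal solution p₊. -/
noncomputable def denomPlus (γ x₀ p₀ g₀ x : ℝ) : ℝ :=
  -g₀ ^ 2 * (x - x₀) ^ 2 + (p₀ * (x - x₀) - 1) ^ 2 + γ * g₀ * (x - x₀) * (p₀ * (x - x₀) - 1)

/-- Denominator of the extremal solution p₋. -/
noncomputable def denomMinus (γ x₀ p₀ g₀ x : ℝ) : ℝ :=
  -g₀ ^ 2 * (x - x₀) ^ 2 + (p₀ * (x - x₀) - 1) ^ 2 - γ * g₀ * (x - x₀) * (p₀ * (x - x₀) - 1)

/-- The extremal solution p₊ of p'' = 6p'p − 4p³ + 2γ(p'−p²)^{3/2} with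
p(x₀) = p₀, p'(x₀) = h₀ = p₀² + g₀². -/
noncomputable def pPlus (γ x₀ p₀ g₀ x : ℝ) : ℝ :=
  (p₀ + (x - x₀) * (g₀ ^ 2 - p₀ ^ 2 - γ * g₀ * p₀)) / denomPlus γ x₀ p₀ g₀ x

/-- The extremal solution p₋ of p'' = 6p'p − 4p³ − 2γ(p'−p²)^{3/2} with
p(x₀) = p₀, p'(x₀) = h₀ = p₀² + g₀². -/
noncomputable def pMinus (γ x₀ p₀ g₀ x : ℝ) : ℝ :=
  (p₀ + (x - x₀) * (g₀ ^ 2 - p₀ ^ 2 + γ * g₀ * p₀)) / denomMinus γ x₀ p₀ g₀ x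
/-- The Hilbert distance on the interval (−1,1). -/
noncomputable def hilbertDist (a b : ℝ) : ℝ :=
  |Real.log (((1 + a) * (1 - b)) / ((1 - a) * (1 + b)))|

/-- The second derivative `p''` prescribed by the extremal equation, in terms of `p` and
`g = √(p' - p²)`. -/
noncomputable def extremalZeta (γ p g : ℝ) : ℝ :=
  6 * (p ^ 2 + g ^ 2) * p - 4 * p ^ 3 + 2 * γ * g ^ 3

/-- The second order Taylor polynomial of the extremal solution. -/
noncomputable def extremalTaylor (γ p g δ : ℝ) : ℝ :=
  p + (p ^ 2 + g ^ 2) * δ + extremalZeta γ p g / 2 * δ ^ 2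

theorem continuous_extremalZeta (γ : ℝ) :
    Continuous (fun z : ℝ × ℝ => extremalZeta γ z.1 z.2) := by
  unfold extremalZeta
  fun_prop

theorem Filter.Tendsto.extremalZeta {ι : Type*} {l : Filter ι} {u v : ι → ℝ} {a b : ℝ}
    (hu : Filter.Tendsto u l (nhds a)) (γ : ℝ) (hv : Filter.Tendsto v l (nhds b)) :
    Filter.Tendsto (fun i => extremalZeta γ (u i) (v i)) l (nhds (extremalZeta γ a b)) := by
  have h := ((continuous_extremalZeta γ).tendsto (a, b)).comp (hu.prodMk_nhds hv)
  exact h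

theorem extremalZeta_bound (γ M : ℝ) :
    ∃ K, 0 ≤ K ∧ ∀ p g : ℝ, |p| ≤ M → |g| ≤ M → |extremalZeta γ p g| ≤ K := by
  obtain ⟨K, hK⟩ := ((isCompact_Icc (a := -M) (b := M)).prod
    (isCompact_Icc (a := -M) (b := M))).exists_bound_of_continuousOn
      (continuous_extremalZeta γ).continuousOn
  refine ⟨max K 0, le_max_right _ _, fun p g hp hg => ?_⟩
  exact (hK (p, g) ⟨abs_le.1 hp, abs_le.1 hg⟩).trans (le_max_left _ _)

theorem pMinus_eq_pPlus_neg (γ x₀ p g x : ℝ) : pMinus γ x₀ p g x = pPlus (-γ) x₀ p g x := by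
  unfold pMinus pPlus denomMinus denomPlus
  ring_nf

theorem pPlus_taylor (γ M : ℝ) :
    ∃ K, 0 ≤ K ∧ ∃ η, 0 < η ∧ ∀ x₀ x p g : ℝ, |p| ≤ M → |g| ≤ M → |x - x₀| < η →
      |pPlus γ x₀ p g x - extremalTaylor γ p g (x - x₀)| ≤ K * |x - x₀| ^ 3 := by
  have hc : IsCompact (Set.Icc (-M) M ×ˢ Set.Icc (-M) M ×ˢ Set.Icc (-1 : ℝ) 1) :=
    isCompact_Icc.prod (isCompact_Icc.prod isCompact_Icc)
  obtain ⟨A, hA⟩ := hc.exists_bound_of_continuousOn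
    (f := fun z : ℝ × ℝ × ℝ => (z.1 ^ 2 - z.2.1 ^ 2 + γ * z.2.1 * z.1) * z.2.2
      - 2 * z.1 - γ * z.2.1) (by fun_prop)
  obtain ⟨B, hB⟩ := hc.exists_bound_of_continuousOn
    (f := fun z : ℝ × ℝ × ℝ => (2 * z.1 + γ * z.2.1) * (extremalZeta γ z.1 z.2.1 / 2)
      - (z.1 ^ 2 - z.2.1 ^ 2 + γ * z.2.1 * z.1) * (z.1 ^ 2 + z.2.1 ^ 2)
      - z.2.2 * (z.1 ^ 2 - z.2.1 ^ 2 + γ * z.2.1 * z.1) * (extremalZeta γ z.1 z.2.1 / 2))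
    (by unfold extremalZeta; fun_prop)
  refine ⟨2 * |B|, by positivity, min 1 (1 / (2 * (|A| + 1))), by positivity, ?_⟩
  intro x₀ x p g hp hg hx
  set δ := x - x₀ with hδ
  have hδ1 : |δ| ≤ 1 := (hx.trans_le (min_le_left _ _)).le
  have hδ2 : |δ| * (2 * (|A| + 1)) ≤ 1 := by
    have := (hx.trans_le (min_le_right _ _)).le
    rwa [le_div_iff₀ (by positivity)] at this
  have hz : (p, g, δ) ∈ Set.Icc (-M) M ×ˢ Set.Icc (-M) M ×ˢ Set.Icc (-1 : ℝ) 1 :=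
    ⟨abs_le.1 hp, abs_le.1 hg, abs_le.1 hδ1⟩
  have hA' := (hA _ hz).trans (le_abs_self A)
  have hB' := (hB _ hz).trans (le_abs_self B)
  simp only [Real.norm_eq_abs] at hA' hB'
  set Q := (p ^ 2 - g ^ 2 + γ * g * p) * δ - 2 * p - γ * g with hQ
  set R := (2 * p + γ * g) * (extremalZeta γ p g / 2)
      - (p ^ 2 - g ^ 2 + γ * g * p) * (p ^ 2 + g ^ 2)
      - δ * (p ^ 2 - g ^ 2 + γ * g * p) * (extremalZeta γ p g / 2) with hR
  have hD : denomPlus γ x₀ p g x = 1 + δ * Q := by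
    unfold denomPlus
    rw [← hδ, hQ]
    ring
  have hDpos : 1 / 2 ≤ 1 + δ * Q := by
    have h1 : |δ * Q| ≤ |δ| * |A| := by
      rw [abs_mul]
      gcongr
    have h2 := neg_abs_le (δ * Q)
    have h3 := abs_nonneg δ
    nlinarith
  have hkey : pPlus γ x₀ p g x - extremalTaylor γ p g δ = δ ^ 3 * R / (1 + δ * Q) := by
    unfold pPlus
    rw [hD, ← hδ]
    have : 1 + δ * Q ≠ 0 := by linarith
    rw [eq_div_iff this, sub_mul, div_mul_cancel₀ _ this, hQ, hR]
    unfold extremalTaylor extremalZeta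
    ring
  rw [hkey, abs_div, abs_mul, abs_pow, abs_of_pos (show 0 < 1 + δ * Q by linarith),
    div_le_iff₀ (by linarith)]
  have h4 : |δ| ^ 3 * |R| ≤ |δ| ^ 3 * |B| := by gcongr
  have h5 : 0 ≤ |B| * |δ| ^ 3 := by positivity
  nlinarith

/-- Applying the Taylor bound at both ends of an interval bounds the slope of `p'`. -/
theorem slope_le_of_taylor_le {γ K p₀ p₁ g₀ g₁ δ : ℝ} (hδ : δ ≠ 0)
    (h₀ : p₁ ≤ extremalTaylor γ p₀ g₀ δ + K * |δ| ^ 3)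
    (h₁ : p₀ ≤ extremalTaylor γ p₁ g₁ (-δ) + K * |δ| ^ 3) :
    ((p₁ ^ 2 + g₁ ^ 2) - (p₀ ^ 2 + g₀ ^ 2)) / δ
      ≤ (extremalZeta γ p₀ g₀ + extremalZeta γ p₁ g₁) / 2 + 2 * K * |δ| := by
  unfold extremalTaylor at h₀ h₁
  have hpos : 0 < |δ| ^ 2 := by positivity
  refine le_of_mul_le_mul_right ?_ hpos
  have e : ((p₁ ^ 2 + g₁ ^ 2) - (p₀ ^ 2 + g₀ ^ 2)) / δ * |δ| ^ 2
      = ((p₁ ^ 2 + g₁ ^ 2) - (p₀ ^ 2 + g₀ ^ 2)) * δ := by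
    rw [sq_abs]
    field_simp
  have e2 := sq_abs δ
  rw [e]
  have e3 : ((extremalZeta γ p₀ g₀ + extremalZeta γ p₁ g₁) / 2 + 2 * K * |δ|) * |δ| ^ 2
     = (extremalZeta γ p₀ g₀ + extremalZeta γ p₁ g₁) / 2 * δ ^ 2 + 2 * K * |δ| ^ 3 := by
    rw [← e2]; ring
  rw [e3]
  linarith

theorem le_slope_of_le_taylor {γ K p₀ p₁ g₀ g₁ δ : ℝ} (hδ : δ ≠ 0)
    (h₀ : extremalTaylor γ p₀ g₀ δ - K * |δ| ^ 3 ≤ p₁)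
    (h₁ : extremalTaylor γ p₁ g₁ (-δ) - K * |δ| ^ 3 ≤ p₀) :
    (extremalZeta γ p₀ g₀ + extremalZeta γ p₁ g₁) / 2 - 2 * K * |δ|
      ≤ ((p₁ ^ 2 + g₁ ^ 2) - (p₀ ^ 2 + g₀ ^ 2)) / δ := by
  unfold extremalTaylor at h₀ h₁
  have hpos : 0 < |δ| ^ 2 := by positivity
  refine le_of_mul_le_mul_right ?_ hpos
  have e : ((p₁ ^ 2 + g₁ ^ 2) - (p₀ ^ 2 + g₀ ^ 2)) / δ * |δ| ^ 2
      = ((p₁ ^ 2 + g₁ ^ 2) - (p₀ ^ 2 + g₀ ^ 2)) * δ := by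
    rw [sq_abs]
    field_simp
  have e2 := sq_abs δ
  rw [e]
  have e3 : ((extremalZeta γ p₀ g₀ + extremalZeta γ p₁ g₁) / 2 - 2 * K * |δ|) * |δ| ^ 2
     = (extremalZeta γ p₀ g₀ + extremalZeta γ p₁ g₁) / 2 * δ ^ 2 - 2 * K * |δ| ^ 3 := by
    rw [← e2]; ring
  rw [e3]
  linarith

theorem sqrt_pow_three_eq_rpow {a : ℝ} (ha : 0 ≤ a) : Real.sqrt a ^ 3 = a ^ ((3 : ℝ) / 2) := by
  rw [Real.sqrt_eq_rpow, ← Real.rpow_natCast, ← Real.rpow_mul ha]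
  norm_num

theorem continuousAt_hilbertDist_left {a : ℝ} (ha : a ∈ Set.Ioo (-1 : ℝ) 1) :
    Filter.Tendsto (fun b => hilbertDist b a) (nhds a) (nhds 0) := by
  have h1 : 0 < 1 + a := by linarith [ha.1]
  have h2 : 0 < 1 - a := by linarith [ha.2]
  have hc : ContinuousAt (fun b => hilbertDist b a) a := by
    unfold hilbertDist
    refine (ContinuousAt.log (ContinuousAt.div (by fun_prop) (by fun_prop) ?_) ?_).abs
    · exact (mul_pos h2 h1).ne'
    · exact (div_pos (mul_pos h1 h2) (mul_pos h2 h1)).ne'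
  have h0 : hilbertDist a a = 0 := by
    unfold hilbertDist
    rw [mul_comm (1 - a), div_self (by positivity)]
    simp
  simpa only [h0] using hc.tendsto

theorem continuousAt_hilbertDist_right {a : ℝ} (ha : a ∈ Set.Ioo (-1 : ℝ) 1) :
    Filter.Tendsto (fun b => hilbertDist a b) (nhds a) (nhds 0) := by
  have h1 : 0 < 1 + a := by linarith [ha.1]
  have h2 : 0 < 1 - a := by linarith [ha.2]
  have hc : ContinuousAt (fun b => hilbertDist a b) a := by
    unfold hilbertDist
    refine (ContinuousAt.log (ContinuousAt.div (by fun_prop) (by fun_prop) ?_) ?_).abs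
    · exact (mul_pos h2 h1).ne'
    · exact (div_pos (mul_pos h1 h2) (mul_pos h2 h1)).ne'
  have h0 : hilbertDist a a = 0 := by
    unfold hilbertDist
    rw [mul_comm (1 - a), div_self (by positivity)]
    simp
  simpa only [h0] using hc.tendsto

section Squeeze

open Filter Topology Set

/-- `p` lies between the two extremal solutions through each of its points, in a Hilbert ball
of radius `ε`. -/
def ExtremalSqueeze (γ ε : ℝ) (p g : ℝ → ℝ) : Prop :=
  ∀ x₀ ∈ Ioo (-1 : ℝ) 1, ∀ x ∈ Ioo (-1 : ℝ) 1, hilbertDist x₀ x < ε →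
    pMinus γ x₀ (p x₀) (g x₀) x ≤ p x ∧ p x ≤ pPlus γ x₀ (p x₀) (g x₀) x

theorem ExtremalSqueeze.hasDerivAt {γ ε : ℝ} (hε : 0 < ε) {p g : ℝ → ℝ}
    (hs : ExtremalSqueeze γ ε p g) {x : ℝ} (hx : x ∈ Ioo (-1 : ℝ) 1) :
    HasDerivAt p (p x ^ 2 + g x ^ 2) x := by
  set M := max |p x| |g x|
  obtain ⟨K, hK, η, hη, hT⟩ := pPlus_taylor γ M
  obtain ⟨K', hK', η', hη', hT'⟩ := pPlus_taylor (-γ) M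
  obtain ⟨C, hC, hZ⟩ := extremalZeta_bound γ M
  obtain ⟨C', hC', hZ'⟩ := extremalZeta_bound (-γ) M
  have hp : |p x| ≤ M := le_max_left _ _
  have hg : |g x| ≤ M := le_max_right _ _
  rw [hasDerivAt_iff_isLittleO]
  have hO : (fun y => p y - p x - (y - x) • (p x ^ 2 + g x ^ 2))
      =O[𝓝 x] fun y => (y - x) ^ 2 := by
    refine Asymptotics.IsBigO.of_bound (C + C' + K + K') ?_
    have hd := (continuousAt_hilbertDist_right hx).eventually (gt_mem_nhds hε)
    filter_upwards [hd, isOpen_Ioo.mem_nhds hx, Metric.ball_mem_nhds x hη,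
      Metric.ball_mem_nhds x hη', Metric.ball_mem_nhds x one_pos] with y hy1 hy2 hy3 hy4 hy5
    rw [Metric.mem_ball, Real.dist_eq] at hy3 hy4 hy5
    obtain ⟨hl, hu⟩ := hs x hx y hy2 hy1
    rw [pMinus_eq_pPlus_neg] at hl
    have a1 := abs_le.1 (hT x y _ _ hp hg hy3)
    have a2 := abs_le.1 (hT' x y _ _ hp hg hy4)
    have b1 := abs_le.1 (hZ _ _ hp hg)
    have b2 := abs_le.1 (hZ' _ _ hp hg)
    unfold extremalTaylor at a1 a2
    rw [Real.norm_eq_abs, Real.norm_eq_abs, abs_pow, smul_eq_mul, sq_abs]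
    have c3 : |y - x| ^ 3 ≤ (y - x) ^ 2 := by
      rw [← sq_abs (y - x)]
      nlinarith [sq_nonneg |y - x|]
    have c2 := sq_nonneg (y - x)
    have d1 : K * |y - x| ^ 3 ≤ K * (y - x) ^ 2 := by gcongr
    have d2 : K' * |y - x| ^ 3 ≤ K' * (y - x) ^ 2 := by gcongr
    have d3 := mul_nonneg hC c2
    have d4 := mul_nonneg hC' c2
    have d5 := mul_nonneg hK c2
    have d6 := mul_nonneg hK' c2
    have e1 := mul_le_mul_of_nonneg_right b1.2 c2
    have e2 := mul_le_mul_of_nonneg_right b2.1 c2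
    rw [abs_le]
    constructor <;> nlinarith
  refine hO.trans_isLittleO ?_
  have h1 : (fun y : ℝ => (y - x)) =o[𝓝 x] fun _ => (1 : ℝ) := by
    rw [Asymptotics.isLittleO_one_iff]
    have : ContinuousAt (fun y : ℝ => y - x) x := by fun_prop
    simpa using this.tendsto
  simpa [pow_two] using h1.mul_isBigO (Asymptotics.isBigO_refl (fun y : ℝ => y - x) (𝓝 x))

theorem ExtremalSqueeze.eventually_slope {γ ε : ℝ} (hε : 0 < ε) {p g : ℝ → ℝ}
    (hs : ExtremalSqueeze γ ε p g) {x M : ℝ} (hx : x ∈ Ioo (-1 : ℝ) 1)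
    (hp : ∀ᶠ y in 𝓝 x, |p y| ≤ M) (hg : ∀ᶠ y in 𝓝 x, |g y| ≤ M) :
    ∃ K, ∀ᶠ δ in 𝓝[≠] (0 : ℝ),
      (p (x + δ) ^ 2 + g (x + δ) ^ 2 - (p x ^ 2 + g x ^ 2)) / δ
        ≤ (extremalZeta γ (p x) (g x) + extremalZeta γ (p (x + δ)) (g (x + δ))) / 2
          + 2 * K * |δ| ∧
      (extremalZeta (-γ) (p x) (g x) + extremalZeta (-γ) (p (x + δ)) (g (x + δ))) / 2
          - 2 * K * |δ|
        ≤ (p (x + δ) ^ 2 + g (x + δ) ^ 2 - (p x ^ 2 + g x ^ 2)) / δ := by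
  obtain ⟨K, hK, η, hη, hT⟩ := pPlus_taylor γ M
  obtain ⟨K', hK', η', hη', hT'⟩ := pPlus_taylor (-γ) M
  refine ⟨max K K', ?_⟩
  have hd := (continuousAt_hilbertDist_right hx).eventually (gt_mem_nhds hε)
  have hd' := (continuousAt_hilbertDist_left hx).eventually (gt_mem_nhds hε)
  have hev : ∀ᶠ y in 𝓝 x, |p y| ≤ M ∧ |g y| ≤ M ∧ y ∈ Ioo (-1 : ℝ) 1 ∧ |y - x| < η ∧
      |y - x| < η' ∧ hilbertDist x y < ε ∧ hilbertDist y x < ε := by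
    filter_upwards [hp, hg, hd, hd', isOpen_Ioo.mem_nhds hx, Metric.ball_mem_nhds x hη,
      Metric.ball_mem_nhds x hη'] with y h1 h2 h3 h4 h5 h6 h7
    exact ⟨h1, h2, h5, h6, h7, h3, h4⟩
  have ht : Tendsto (fun δ : ℝ => x + δ) (𝓝[≠] 0) (𝓝 x) := by
    have : ContinuousAt (fun δ : ℝ => x + δ) 0 := by fun_prop
    have h2 := this.tendsto
    rw [add_zero] at h2
    exact h2.mono_left nhdsWithin_le_nhds
  have hp0 := hp.self_of_nhds
  have hg0 := hg.self_of_nhds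
  filter_upwards [ht.eventually hev, self_mem_nhdsWithin] with δ ⟨h1, h2, h3, h4, h5, h6, h7⟩ hδ
  have hδ0 : δ ≠ 0 := hδ
  have e1 : x + δ - x = δ := by ring
  have e2 : x - (x + δ) = -δ := by ring
  rw [e1] at h4 h5
  obtain ⟨l0, u0⟩ := hs x hx _ h3 h6
  obtain ⟨l1, u1⟩ := hs _ h3 x hx h7
  rw [pMinus_eq_pPlus_neg] at l0 l1
  have a0 := hT x (x + δ) _ _ hp0 hg0 (by rwa [e1])
  have a1 := hT (x + δ) x _ _ h1 h2 (by rwa [e2, abs_neg])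
  have b0 := hT' x (x + δ) _ _ hp0 hg0 (by rwa [e1])
  have b1 := hT' (x + δ) x _ _ h1 h2 (by rwa [e2, abs_neg])
  rw [e1, abs_le] at a0 b0
  rw [e2, abs_neg, abs_le] at a1 b1
  have k1 : K * |δ| ^ 3 ≤ max K K' * |δ| ^ 3 := by gcongr; exact le_max_left _ _
  have k2 : K' * |δ| ^ 3 ≤ max K K' * |δ| ^ 3 := by gcongr; exact le_max_right _ _
  exact ⟨slope_le_of_taylor_le hδ0 (by linarith) (by linarith),
    le_slope_of_le_taylor hδ0 (by linarith) (by linarith)⟩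

theorem ExtremalSqueeze.continuousAt_deriv {γ ε : ℝ} (hε : 0 < ε) {p g : ℝ → ℝ}
    (hs : ExtremalSqueeze γ ε p g) {x M : ℝ} (hx : x ∈ Ioo (-1 : ℝ) 1)
    (hp : ∀ᶠ y in 𝓝 x, |p y| ≤ M) (hg : ∀ᶠ y in 𝓝 x, |g y| ≤ M) :
    ContinuousAt (fun y => p y ^ 2 + g y ^ 2) x := by
  obtain ⟨K, hK⟩ := hs.eventually_slope hε hx hp hg
  obtain ⟨C, hC, hZ⟩ := extremalZeta_bound γ M
  obtain ⟨C', hC', hZ'⟩ := extremalZeta_bound (-γ) M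
  have ht : Tendsto (fun δ : ℝ => x + δ) (𝓝[≠] 0) (𝓝 x) := by
    have : ContinuousAt (fun δ : ℝ => x + δ) 0 := by fun_prop
    have h2 := this.tendsto
    rw [add_zero] at h2
    exact h2.mono_left nhdsWithin_le_nhds
  have hO : (fun δ => p (x + δ) ^ 2 + g (x + δ) ^ 2 - (p x ^ 2 + g x ^ 2))
      =O[𝓝[≠] 0] fun δ : ℝ => δ := by
    refine Asymptotics.IsBigO.of_bound (C + C' + 2 * |K|) ?_
    have h1 : ∀ᶠ δ : ℝ in 𝓝[≠] 0, |δ| < 1 := by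
      filter_upwards [nhdsWithin_le_nhds (Metric.ball_mem_nhds (0 : ℝ) one_pos)] with δ hδ
      simpa using hδ
    filter_upwards [hK, self_mem_nhdsWithin, ht.eventually hp, ht.eventually hg, h1] with
      δ ⟨hu, hl⟩ hδ hpδ hgδ hδ1
    have hδ0 : 0 < |δ| := abs_pos.2 hδ
    rw [Real.norm_eq_abs, Real.norm_eq_abs, ← div_le_iff₀ hδ0, ← abs_div, abs_le]
    have a1 := abs_le.1 (hZ _ _ hp.self_of_nhds hg.self_of_nhds)
    have a2 := abs_le.1 (hZ _ _ hpδ hgδ)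
    have b1 := abs_le.1 (hZ' _ _ hp.self_of_nhds hg.self_of_nhds)
    have b2 := abs_le.1 (hZ' _ _ hpδ hgδ)
    have k : K * |δ| ≤ |K| := by
      nlinarith [le_abs_self K, abs_nonneg K]
    constructor <;> linarith
  have h0 := hO.trans_tendsto
    ((tendsto_id (α := ℝ) (x := 𝓝 0)).mono_left nhdsWithin_le_nhds)
  rw [continuousAt_iff_punctured_nhds]
  have h1 : Tendsto (fun y : ℝ => y - x) (𝓝[≠] x) (𝓝[≠] 0) := by
    refine tendsto_nhdsWithin_iff.2 ⟨?_, ?_⟩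
    · have : ContinuousAt (fun y : ℝ => y - x) x := by fun_prop
      have h2 := this.tendsto
      rw [sub_self] at h2
      exact h2.mono_left nhdsWithin_le_nhds
    · filter_upwards [self_mem_nhdsWithin] with y hy
      exact sub_ne_zero.2 hy
  have h2 := (h0.comp h1).add_const (p x ^ 2 + g x ^ 2)
  simpa [Function.comp_def] using h2

theorem ExtremalSqueeze.limsup_slope_le {γ ε : ℝ} (hε : 0 < ε) {p g : ℝ → ℝ}
    (hs : ExtremalSqueeze γ ε p g) {x : ℝ} (hx : x ∈ Ioo (-1 : ℝ) 1)
    (hp : ContinuousAt p x) (hg : ContinuousAt g x) {F : ℝ → ℝ}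
    (hF : ∀ᶠ δ in 𝓝[≠] (0 : ℝ),
      F δ = (p (x + δ) ^ 2 + g (x + δ) ^ 2 - (p x ^ 2 + g x ^ 2)) / δ) :
    limsup F (𝓝[≠] 0) ≤ extremalZeta γ (p x) (g x) ∧
      extremalZeta (-γ) (p x) (g x) ≤ liminf F (𝓝[≠] 0) := by
  have hM : ∀ {q : ℝ → ℝ}, ContinuousAt q x → |q x| < max (|p x|) (|g x|) + 1 →
      ∀ᶠ y in 𝓝 x, |q y| ≤ max (|p x|) (|g x|) + 1 := fun hq h =>
    (hq.abs.eventually (gt_mem_nhds h)).mono fun y hy => hy.le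
  obtain ⟨K, hK⟩ := hs.eventually_slope hε hx
    (hM hp ((le_max_left _ _).trans_lt (lt_add_one _)))
    (hM hg ((le_max_right _ _).trans_lt (lt_add_one _)))
  have ht : Tendsto (fun δ : ℝ => x + δ) (𝓝[≠] 0) (𝓝 x) := by
    have : ContinuousAt (fun δ : ℝ => x + δ) 0 := by fun_prop
    have h2 := this.tendsto
    rw [add_zero] at h2
    exact h2.mono_left nhdsWithin_le_nhds
  have hδ : Tendsto (fun δ : ℝ => 2 * K * |δ|) (𝓝[≠] 0) (𝓝 0) := by
    have : ContinuousAt (fun δ : ℝ => 2 * K * |δ|) 0 := by fun_prop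
    have h2 := this.tendsto
    rw [abs_zero, mul_zero] at h2
    exact h2.mono_left nhdsWithin_le_nhds
  have hZ : ∀ c : ℝ, Tendsto (fun δ : ℝ =>
      (extremalZeta c (p x) (g x) + extremalZeta c (p (x + δ)) (g (x + δ))) / 2)
      (𝓝[≠] 0) (𝓝 (extremalZeta c (p x) (g x))) := by
    intro c
    have h1 : Tendsto (fun δ : ℝ => extremalZeta c (p (x + δ)) (g (x + δ))) (𝓝[≠] 0)
        (𝓝 (extremalZeta c (p x) (g x))) := by
      have hp' : Tendsto (fun δ : ℝ => p (x + δ)) (𝓝[≠] 0) (𝓝 (p x)) := hp.tendsto.comp ht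
      have hg' : Tendsto (fun δ : ℝ => g (x + δ)) (𝓝[≠] 0) (𝓝 (g x)) := hg.tendsto.comp ht
      exact hp'.extremalZeta c hg'
    have h2 := (h1.const_add (extremalZeta c (p x) (g x))).div_const 2
    rwa [add_self_div_two] at h2
  have hU := (hZ γ).add hδ
  have hL := (hZ (-γ)).sub hδ
  rw [add_zero] at hU
  rw [sub_zero] at hL
  have hFU := hF.and hK
  have leU : ∀ᶠ δ in 𝓝[≠] (0 : ℝ), F δ ≤
      (extremalZeta γ (p x) (g x) + extremalZeta γ (p (x + δ)) (g (x + δ))) / 2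
        + 2 * K * |δ| := hFU.mono fun δ h => h.1 ▸ h.2.1
  have leL : ∀ᶠ δ in 𝓝[≠] (0 : ℝ),
      (extremalZeta (-γ) (p x) (g x) + extremalZeta (-γ) (p (x + δ)) (g (x + δ))) / 2
        - 2 * K * |δ| ≤ F δ := hFU.mono fun δ h => h.1 ▸ h.2.2
  have bU : IsBoundedUnder (· ≤ ·) (𝓝[≠] (0 : ℝ)) F := hU.isBoundedUnder_le.mono_le leU
  have bL : IsBoundedUnder (· ≥ ·) (𝓝[≠] (0 : ℝ)) F := hL.isBoundedUnder_ge.mono_ge leL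
  constructor
  · exact (limsup_le_limsup leU bL.isCoboundedUnder_le hU.isBoundedUnder_le).trans_eq
      hU.limsup_eq
  · exact hL.liminf_eq.symm.trans_le
      (liminf_le_liminf leL hL.isBoundedUnder_ge bU.isCoboundedUnder_ge)

end Squeeze

section LogBounds

open Filter Topology Set

/-- The primitive of `x ↦ b / (1 - x) - a / (1 + x)` vanishing at `0`. -/
noncomputable def logBarrier (a b x : ℝ) : ℝ :=
  -a * Real.log (1 + x) - b * Real.log (1 - x)

theorem logBarrier_zero (a b : ℝ) : logBarrier a b 0 = 0 := by
  simp [logBarrier]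

theorem hasDerivAt_logBarrier (a b : ℝ) {x : ℝ} (hx : x ∈ Ioo (-1 : ℝ) 1) :
    HasDerivAt (logBarrier a b) (b / (1 - x) - a / (1 + x)) x := by
  have h1 : 1 + x ≠ 0 := by linarith [hx.1]
  have h2 : 1 - x ≠ 0 := by linarith [hx.2]
  have d1 := (((hasDerivAt_id x).const_add 1).log h1).const_mul (-a)
  have d2 := (((hasDerivAt_id x).const_sub 1).log h2).const_mul b
  refine (d1.sub d2).congr_deriv ?_
  simp only [id]
  ring

theorem tendsto_logBarrier_abs {a b : ℝ} (hb : 0 < b) {l : Filter ℝ}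
    (hl : Tendsto (fun x : ℝ => |x|) l (𝓝[<] 1)) :
    Tendsto (fun x => logBarrier a b |x|) l atTop := by
  have key : Tendsto (logBarrier a b) (𝓝[<] 1) atTop := by
    have h1 : Tendsto (fun x : ℝ => 1 - x) (𝓝[<] 1) (𝓝[>] 0) := by
      refine tendsto_nhdsWithin_iff.2 ⟨?_, ?_⟩
      · have : ContinuousAt (fun x : ℝ => 1 - x) 1 := by fun_prop
        have h2 := this.tendsto
        rw [sub_self] at h2
        exact h2.mono_left nhdsWithin_le_nhds
      · filter_upwards [self_mem_nhdsWithin] with x hx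
        exact sub_pos.2 (mem_Iio.1 hx)
    have h2 : Tendsto (fun x : ℝ => -b * Real.log (1 - x)) (𝓝[<] 1) atTop :=
      (Real.tendsto_log_nhdsGT_zero.comp h1).const_mul_atBot_of_neg (neg_lt_zero.2 hb)
    have h3 : Tendsto (fun x : ℝ => -a * Real.log (1 + x)) (𝓝[<] 1)
        (𝓝 (-a * Real.log (1 + 1))) := by
      have : ContinuousAt (fun x : ℝ => -a * Real.log (1 + x)) 1 :=
        continuousAt_const.mul (ContinuousAt.log (by fun_prop) (by norm_num))
      exact this.tendsto.mono_left nhdsWithin_le_nhds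
    refine (h3.add_atTop h2).congr fun x => ?_
    unfold logBarrier
    ring
  exact key.comp hl

/-- Comparison of two primitives vanishing at `0`, on both sides of `0`. -/
theorem le_of_deriv_le_of_zero {u v u' v' : ℝ → ℝ} (hu : ∀ x ∈ Ioo (-1 : ℝ) 1,
    HasDerivAt u (u' x) x) (hv : ∀ x ∈ Ioo (-1 : ℝ) 1, HasDerivAt v (v' x) x)
    (hle : ∀ x ∈ Ioo (-1 : ℝ) 1, u' x ≤ v' x) (hu0 : u 0 = 0) (hv0 : v 0 = 0)
    {x : ℝ} (hx : x ∈ Ioo (-1 : ℝ) 1) :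
    (0 ≤ x → u x ≤ v x) ∧ (x ≤ 0 → v x ≤ u x) := by
  have hmono : MonotoneOn (fun y => v y - u y) (Ioo (-1 : ℝ) 1) := by
    refine monotoneOn_of_deriv_nonneg (convex_Ioo _ _) ?_ ?_ ?_
    · exact fun y hy => ((hv y hy).sub (hu y hy)).continuousAt.continuousWithinAt
    · rw [interior_Ioo]
      exact fun y hy => ((hv y hy).sub (hu y hy)).differentiableAt.differentiableWithinAt
    · rw [interior_Ioo]
      intro y hy
      have e := ((hv y hy).sub (hu y hy)).deriv
      have e' : deriv (fun y => v y - u y) y = v' y - u' y := e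
      rw [e']
      exact sub_nonneg.2 (hle y hy)
  have h0 : (0 : ℝ) ∈ Ioo (-1 : ℝ) 1 := by norm_num
  constructor
  · intro h
    have := hmono h0 hx h
    simp only [hu0, hv0] at this
    linarith
  · intro h
    have := hmono hx h0 h
    simp only [hu0, hv0] at this
    linarith

end LogBounds

section Interval

open Filter Topology Set

theorem hasDerivAt_integral_of_continuousOn_Ioo {p : ℝ → ℝ}
    (hp : ContinuousOn p (Ioo (-1 : ℝ) 1)) {x : ℝ} (hx : x ∈ Ioo (-1 : ℝ) 1) :
    HasDerivAt (fun x => ∫ s in (0 : ℝ)..x, p s) (p x) x := by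
  have h0 : (0 : ℝ) ∈ Ioo (-1 : ℝ) 1 := by norm_num
  refine intervalIntegral.integral_hasDerivAt_right ?_ ?_ (hp.continuousAt (isOpen_Ioo.mem_nhds hx))
  · exact (hp.mono (ordConnected_Ioo.uIcc_subset h0 hx)).intervalIntegrable
  · exact hp.stronglyMeasurableAtFilter isOpen_Ioo x hx

theorem contDiffOn_two_of_hasDerivAt {f p h : ℝ → ℝ} {s : Set ℝ} (hs : IsOpen s)
    (hf : ∀ x ∈ s, HasDerivAt f (p x) x) (hp : ∀ x ∈ s, HasDerivAt p (h x) x)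
    (hh : ContinuousOn h s) : ContDiffOn ℝ 2 f s := by
  have h1 : ContDiffOn ℝ 1 p s := by
    rw [show (1 : WithTop ℕ∞) = 0 + 1 by norm_num, contDiffOn_succ_iff_deriv_of_isOpen hs]
    refine ⟨fun x hx => (hp x hx).differentiableAt.differentiableWithinAt, by simp, ?_⟩
    rw [contDiffOn_zero]
    exact hh.congr fun x hx => (hp x hx).deriv
  rw [show (2 : WithTop ℕ∞) = 1 + 1 by norm_num, contDiffOn_succ_iff_deriv_of_isOpen hs]
  exact ⟨fun x hx => (hf x hx).differentiableAt.differentiableWithinAt, by simp,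
    h1.congr fun x hx => (hf x hx).deriv⟩

end Interval

/-- Under the hypotheses of Statement 4 (chains of inequalities and squeezing
between the extremal solutions at Hilbert distance < ε), the function f(x) = ∫₀ˣ p(s) ds is
ν-admissible on [−1,1] and satisfies the logarithmic bounds
−((ν−1)/ν)log(1+|x|) − (1/ν)log(1−|x|) ≤ f(x) ≤ −((ν−1)/ν)log(1−|x|) − (1/ν)log(1+|x|);
in particular it grows like −log(1−|x|) as x → ±1. -/
theorem stmt_5 (ν : ℝ) (hν : 2 ≤ ν) (γ : ℝ) (hγ : γ = (ν - 2) / Real.sqrt (ν - 1))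
    (ε : ℝ) (hε : 0 < ε) (p h : ℝ → ℝ)
    (hchain : ∀ x ∈ Set.Ioo (-1 : ℝ) 1,
      (Real.sqrt (h x - p x ^ 2) / Real.sqrt (ν - 1) ≤ p x + 1 / (1 + x) ∧
        p x + 1 / (1 + x) ≤ Real.sqrt (ν - 1) * Real.sqrt (h x - p x ^ 2)) ∧
      (Real.sqrt (h x - p x ^ 2) / Real.sqrt (ν - 1) ≤ -p x + 1 / (1 - x) ∧
        -p x + 1 / (1 - x) ≤ Real.sqrt (ν - 1) * Real.sqrt (h x - p x ^ 2)))
    (hsqueeze : ∀ x₀ ∈ Set.Ioo (-1 : ℝ) 1, ∀ x ∈ Set.Ioo (-1 : ℝ) 1,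
      hilbertDist x₀ x < ε →
        pMinus γ x₀ (p x₀) (Real.sqrt (h x₀ - p x₀ ^ 2)) x ≤ p x ∧
        p x ≤ pPlus γ x₀ (p x₀) (Real.sqrt (h x₀ - p x₀ ^ 2)) x)
    (f : ℝ → ℝ) (hf : ∀ x, f x = ∫ s in (0 : ℝ)..x, p s) :
    Admissible1D ν f ∧
    ∀ x ∈ Set.Ioo (-1 : ℝ) 1,
      -((ν - 1) / ν) * Real.log (1 + |x|) - (1 / ν) * Real.log (1 - |x|) ≤ f x ∧
      f x ≤ -((ν - 1) / ν) * Real.log (1 - |x|) - (1 / ν) * Real.log (1 + |x|) := by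
  have hν1 : 0 < ν - 1 := by linarith
  have hν0 : 0 < ν := by linarith
  set s := Real.sqrt (ν - 1) with hs
  have hs0 : 0 < s := Real.sqrt_pos.2 hν1
  have hss : s * s = ν - 1 := Real.mul_self_sqrt hν1.le
  set g : ℝ → ℝ := fun x => Real.sqrt (h x - p x ^ 2) with hg
  have hgnn : ∀ x, 0 ≤ g x := fun x => Real.sqrt_nonneg _
  have hgpos : ∀ x ∈ Set.Ioo (-1 : ℝ) 1, 0 < g x := by
    intro x hx
    have h1 : 0 < 1 / (1 + x) := one_div_pos.2 (by linarith [hx.1])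
    have h2 : 0 < 1 / (1 - x) := one_div_pos.2 (by linarith [hx.2])
    obtain ⟨⟨-, c2⟩, ⟨-, c4⟩⟩ := hchain x hx
    by_contra hcon
    have hz : g x = 0 := le_antisymm (not_lt.1 hcon) (hgnn x)
    change _ ≤ s * g x at c2
    change _ ≤ s * g x at c4
    rw [hz, mul_zero] at c2 c4
    linarith
  have hpos : ∀ x ∈ Set.Ioo (-1 : ℝ) 1, 0 < h x - p x ^ 2 := fun x hx =>
    Real.sqrt_pos.1 (hgpos x hx)
  have hh : ∀ x ∈ Set.Ioo (-1 : ℝ) 1, h x = p x ^ 2 + g x ^ 2 := by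
    intro x hx
    have : g x ^ 2 = h x - p x ^ 2 := Real.sq_sqrt (hpos x hx).le
    rw [this]
    ring
  have hsq : ExtremalSqueeze γ ε p g := hsqueeze
  have hpd : ∀ x ∈ Set.Ioo (-1 : ℝ) 1, HasDerivAt p (h x) x := fun x hx =>
    hh x hx ▸ hsq.hasDerivAt hε hx
  have hpc : ∀ x ∈ Set.Ioo (-1 : ℝ) 1, ContinuousAt p x := fun x hx => (hpd x hx).continuousAt
  have hfd : ∀ x ∈ Set.Ioo (-1 : ℝ) 1, HasDerivAt f (p x) x := by
    intro x hx
    rw [show f = fun x => ∫ s in (0 : ℝ)..x, p s from funext hf]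
    exact hasDerivAt_integral_of_continuousOn_Ioo
      (fun y hy => (hpc y hy).continuousWithinAt) hx
  have hhc' : ∀ x ∈ Set.Ioo (-1 : ℝ) 1, ContinuousAt (fun y => p y ^ 2 + g y ^ 2) x := by
    intro x hx
    refine hsq.continuousAt_deriv hε
      (M := max (|p x| + 1) (s * (p x + 1 / (1 + x)) + 1)) hx ?_ ?_
    · filter_upwards [(hpc x hx).abs.eventually (gt_mem_nhds (lt_add_one _))] with y hy
      exact hy.le.trans (le_max_left _ _)
    · have hB : ContinuousAt (fun y => s * (p y + 1 / (1 + y))) x := by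
        have : 1 + x ≠ 0 := by linarith [hx.1]
        have := hpc x hx
        fun_prop (disch := assumption)
      filter_upwards [hB.eventually (gt_mem_nhds (lt_add_one _)), isOpen_Ioo.mem_nhds hx]
        with y hy hy'
      rw [abs_of_nonneg (hgnn y)]
      have c := (hchain y hy').1.1
      rw [div_le_iff₀ hs0, mul_comm] at c
      exact (c.trans hy.le).trans (le_max_right _ _)
  have hev : ∀ x ∈ Set.Ioo (-1 : ℝ) 1, h =ᶠ[nhds x] fun y => p y ^ 2 + g y ^ 2 := fun x hx =>
    Filter.eventuallyEq_of_mem (isOpen_Ioo.mem_nhds hx) hh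
  have hhc : ∀ x ∈ Set.Ioo (-1 : ℝ) 1, ContinuousAt h x := fun x hx =>
    (hhc' x hx).congr (hev x hx).symm
  have hgc : ∀ x ∈ Set.Ioo (-1 : ℝ) 1, ContinuousAt g x := fun x hx =>
    ((hhc x hx).sub ((hpc x hx).pow 2)).sqrt
  have hd1 : ∀ x ∈ Set.Ioo (-1 : ℝ) 1, deriv f x = p x := fun x hx => (hfd x hx).deriv
  have hd2 : ∀ x ∈ Set.Ioo (-1 : ℝ) 1, deriv (deriv f) x = h x := by
    intro x hx
    have : deriv f =ᶠ[nhds x] p := Filter.eventuallyEq_of_mem (isOpen_Ioo.mem_nhds hx) hd1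
    rw [this.deriv_eq, (hpd x hx).deriv]
  have hf0 : f 0 = 0 := by rw [hf, intervalIntegral.integral_same]
  have hup : ∀ x ∈ Set.Ioo (-1 : ℝ) 1,
      p x ≤ (ν - 1) / ν / (1 - x) - 1 / ν / (1 + x) ∧
      1 / ν / (1 - x) - (ν - 1) / ν / (1 + x) ≤ p x := by
    intro x hx
    obtain ⟨⟨c1, c2⟩, ⟨c3, c4⟩⟩ := hchain x hx
    rw [div_le_iff₀ hs0] at c1 c3
    have k1 := c2.trans (mul_le_mul_of_nonneg_left c3 hs0.le)
    have k2 := c4.trans (mul_le_mul_of_nonneg_left c1 hs0.le)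
    have k1' : p x + 1 / (1 + x) ≤ (ν - 1) * (-p x + 1 / (1 - x)) := by
      rw [← hss]; linarith
    have k2' : -p x + 1 / (1 - x) ≤ (ν - 1) * (p x + 1 / (1 + x)) := by
      rw [← hss]; linarith
    have e1 : (ν - 1) / ν / (1 - x) - 1 / ν / (1 + x)
        = ((ν - 1) * (1 / (1 - x)) - 1 / (1 + x)) / ν := by ring
    have e2 : 1 / ν / (1 - x) - (ν - 1) / ν / (1 + x)
        = (1 / (1 - x) - (ν - 1) * (1 / (1 + x))) / ν := by ring
    rw [e1, e2, le_div_iff₀ hν0, div_le_iff₀ hν0]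
    constructor <;> linarith
  have hbounds : ∀ x ∈ Set.Ioo (-1 : ℝ) 1,
      -((ν - 1) / ν) * Real.log (1 + |x|) - (1 / ν) * Real.log (1 - |x|) ≤ f x ∧
      f x ≤ -((ν - 1) / ν) * Real.log (1 - |x|) - (1 / ν) * Real.log (1 + |x|) := by
    intro x hx
    have hL := le_of_deriv_le_of_zero
      (fun y hy => hasDerivAt_logBarrier ((ν - 1) / ν) (1 / ν) hy) hfd
      (fun y hy => (hup y hy).2) (logBarrier_zero _ _) hf0 hx
    have hU := le_of_deriv_le_of_zero hfd
      (fun y hy => hasDerivAt_logBarrier (1 / ν) ((ν - 1) / ν) hy)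
      (fun y hy => (hup y hy).1) hf0 (logBarrier_zero _ _) hx
    unfold logBarrier at hL hU
    rcases le_total 0 x with h0 | h0
    · have a1 := hL.1 h0
      have a2 := hU.1 h0
      rw [abs_of_nonneg h0]
      constructor <;> linarith
    · have a1 := hL.2 h0
      have a2 := hU.2 h0
      rw [abs_of_nonpos h0, sub_neg_eq_add, ← sub_eq_add_neg]
      constructor <;> linarith
  have hblow : ∀ x₀ : ℝ, |x₀| = 1 →
      Filter.Tendsto f (nhdsWithin x₀ (Set.Ioo (-1 : ℝ) 1)) Filter.atTop := by
    intro x₀ h0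
    have hl : Filter.Tendsto (fun x : ℝ => |x|) (nhdsWithin x₀ (Set.Ioo (-1 : ℝ) 1))
        (nhdsWithin 1 (Set.Iio 1)) := by
      refine tendsto_nhdsWithin_iff.2 ⟨?_, ?_⟩
      · rw [← h0]
        exact (continuous_abs.tendsto x₀).mono_left nhdsWithin_le_nhds
      · filter_upwards [self_mem_nhdsWithin] with x hx
        exact abs_lt.2 hx
    refine Filter.tendsto_atTop_mono' _ ?_
      (tendsto_logBarrier_abs (a := (ν - 1) / ν) (one_div_pos.2 hν0) hl)
    filter_upwards [self_mem_nhdsWithin] with x hx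
    exact (hbounds x hx).1
  refine ⟨⟨contDiffOn_two_of_hasDerivAt isOpen_Ioo hfd hpd
    fun x hx => (hhc x hx).continuousWithinAt, ?_, hblow 1 (by norm_num), hblow (-1) (by norm_num),
    ?_⟩, hbounds⟩
  · intro x hx
    rw [hd1 x hx, hd2 x hx]
    exact hpos x hx
  · intro x hx
    have hF : ∀ᶠ δ in nhdsWithin (0 : ℝ) {(0 : ℝ)}ᶜ,
        (deriv (deriv f) (x + δ) - deriv (deriv f) x) / δ
          = (p (x + δ) ^ 2 + g (x + δ) ^ 2 - (p x ^ 2 + g x ^ 2)) / δ := by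
      have hc : ContinuousAt (fun δ : ℝ => x + δ) 0 := by fun_prop
      have hm := hc.eventually (isOpen_Ioo.mem_nhds (show x + 0 ∈ Set.Ioo (-1 : ℝ) 1 by simpa))
      filter_upwards [nhdsWithin_le_nhds hm] with δ hδ
      rw [hd2 _ hδ, hd2 x hx, hh _ hδ, hh x hx]
    have hlim := hsq.limsup_slope_le hε hx (hpc x hx) (hgc x hx) hF
    have hrp : (h x - p x ^ 2) ^ ((3 : ℝ) / 2) = g x ^ 3 :=
      (sqrt_pow_three_eq_rpow (hpos x hx).le).symm
    have z1 : zetaPlus ((ν - 2) / s) (p x) (h x) = extremalZeta γ (p x) (g x) := by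
      unfold zetaPlus extremalZeta
      rw [hrp, hh x hx, hγ]
    have z2 : zetaMinus ((ν - 2) / s) (p x) (h x) = extremalZeta (-γ) (p x) (g x) := by
      unfold zetaMinus extremalZeta
      rw [hrp, hh x hx, hγ]
      ring
    rw [← z1, ← z2, ← hd1 x hx, ← hd2 x hx] at hlim
    exact hlim
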